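/- Let k be a field with char(k) ≠ 2, let a, b ∈ k^×, and suppose there exist u, v ∈ k with u² = −a and v² = −b. Let q = ⟨−a,−b,ab⟩ with Gram matrix Q = diag(−a,−b,ab), and let D₀ = {I₃, diag(1,−1,−1), diag(−1,1,−1), diag(−1,−1,1)} ⊆ SO(q)(k). Then the normalizer of D₀ in SO(q)(k) is isomorphic to the symmetric group S₄; explicitly, it is the semidirect product of D₀ with the subgroup N' ≅ S₃ generated by the matrices [[0, v u⁻¹, 0],[0,0,u],[v⁻¹,0,0]] and [[−1,0,0],[0,0,−u],[0,−u⁻¹,0]]. -/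

import Mathlib

open Matrix

/-- The special orthogonal group `SO(q)(k)` of a ternary quadratic form with Gram matrix `Q`,
realized as the subgroup of `GL (Fin 3) k` consisting of the matrices `M` with
`Mᵀ * Q * M = Q` and `det M = 1`. -/
def SO3 (k : Type) [Field k] (Q : Matrix (Fin 3) (Fin 3) k) :
    Subgroup (GL (Fin 3) k) where
  carrier := {M | (M : Matrix (Fin 3) (Fin 3) k)ᵀ * Q * (M : Matrix (Fin 3) (Fin 3) k) = Q ∧
      (M : Matrix (Fin 3) (Fin 3) k).det = 1}
  one_mem' := by
    constructor
    · simp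
    · simp
  mul_mem' := by
    rintro A B ⟨hA, hA'⟩ ⟨hB, hB'⟩
    constructor
    · have hAB : ((A * B : GL (Fin 3) k) : Matrix (Fin 3) (Fin 3) k)
        = (A : Matrix (Fin 3) (Fin 3) k) * (B : Matrix (Fin 3) (Fin 3) k) := rfl
      rw [hAB, transpose_mul]
      calc (B : Matrix (Fin 3) (Fin 3) k)ᵀ * (A : Matrix (Fin 3) (Fin 3) k)ᵀ * Q *
            ((A : Matrix (Fin 3) (Fin 3) k) * (B : Matrix (Fin 3) (Fin 3) k))
          = (B : Matrix (Fin 3) (Fin 3) k)ᵀ *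
            ((A : Matrix (Fin 3) (Fin 3) k)ᵀ * Q * (A : Matrix (Fin 3) (Fin 3) k)) *
            (B : Matrix (Fin 3) (Fin 3) k) := by noncomm_ring
        _ = Q := by rw [hA, hB]
    · have hAB : ((A * B : GL (Fin 3) k) : Matrix (Fin 3) (Fin 3) k)
        = (A : Matrix (Fin 3) (Fin 3) k) * (B : Matrix (Fin 3) (Fin 3) k) := rfl
      rw [hAB, det_mul, hA', hB', one_mul]
  inv_mem' := by
    rintro A ⟨hA, hA'⟩
    have hinv : ((A⁻¹ : GL (Fin 3) k) : Matrix (Fin 3) (Fin 3) k)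
        = (A : Matrix (Fin 3) (Fin 3) k)⁻¹ := by
      simp [Matrix.coe_units_inv]
    have h1 : (A : Matrix (Fin 3) (Fin 3) k) * ((A⁻¹ : GL (Fin 3) k) : Matrix (Fin 3) (Fin 3) k)
        = 1 := by
      rw [hinv]
      exact Matrix.mul_nonsing_inv _ (by rw [hA']; exact isUnit_one)
    constructor
    · calc ((A⁻¹ : GL (Fin 3) k) : Matrix (Fin 3) (Fin 3) k)ᵀ * Q *
            ((A⁻¹ : GL (Fin 3) k) : Matrix (Fin 3) (Fin 3) k)
          = ((A⁻¹ : GL (Fin 3) k) : Matrix (Fin 3) (Fin 3) k)ᵀ *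
            ((A : Matrix (Fin 3) (Fin 3) k)ᵀ * Q * (A : Matrix (Fin 3) (Fin 3) k)) *
            ((A⁻¹ : GL (Fin 3) k) : Matrix (Fin 3) (Fin 3) k) := by rw [hA]
        _ = ((A : Matrix (Fin 3) (Fin 3) k) *
              ((A⁻¹ : GL (Fin 3) k) : Matrix (Fin 3) (Fin 3) k))ᵀ * Q *
            ((A : Matrix (Fin 3) (Fin 3) k) *
              ((A⁻¹ : GL (Fin 3) k) : Matrix (Fin 3) (Fin 3) k)) := by
            rw [transpose_mul]; noncomm_ring
        _ = Q := by rw [h1]; simp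
    · rw [hinv, Matrix.det_nonsing_inv, hA']; simp

/-- The diagonal Klein four subgroup `D₀` of `SO(q)(k)`, as a set of matrices. -/
def kleinFourSet (k : Type) [Field k] : Set (Matrix (Fin 3) (Fin 3) k) :=
  {Matrix.diagonal ![(1 : k), 1, 1], Matrix.diagonal ![1, -1, -1],
    Matrix.diagonal ![-1, 1, -1], Matrix.diagonal ![-1, -1, 1]}

open Equiv Equiv.Perm

/-- The four long diagonals of the cube `[-1, 1]³`. -/
def cubeDiagonal : Fin 4 → Fin 3 → ℤ :=
  ![![1, 1, 1], ![1, -1, -1], ![-1, 1, -1], ![-1, -1, 1]]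

/-- The matrix of the symmetry of the tetrahedron permuting its vertices `cubeDiagonal` by `σ`. -/
def tetrahedralMatrix (σ : Perm (Fin 4)) : Matrix (Fin 3) (Fin 3) ℤ :=
  fun i j => (∑ m, cubeDiagonal (σ m) i * cubeDiagonal m j) / 4

theorem tetrahedralMatrix_one : tetrahedralMatrix 1 = 1 := by decide +kernel

theorem tetrahedralMatrix_mul (σ τ : Perm (Fin 4)) :
    tetrahedralMatrix (σ * τ) = tetrahedralMatrix σ * tetrahedralMatrix τ := by
  revert σ τ
  decide +kernel

/-- The isomorphism of `S₄` with the rotation group of the cube, as a map to integer matrices. -/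
def cubeRotation : Perm (Fin 4) →* Matrix (Fin 3) (Fin 3) ℤ where
  toFun σ := (sign σ : ℤ) • tetrahedralMatrix σ
  map_one' := by simp [tetrahedralMatrix_one]
  map_mul' σ τ := by
    rw [Perm.sign_mul, tetrahedralMatrix_mul, smul_mul_smul_comm, Units.val_mul]

theorem cubeRotation_transpose_mul_self (σ : Perm (Fin 4)) :
    (cubeRotation σ)ᵀ * cubeRotation σ = 1 := by
  revert σ
  decide +kernel

theorem det_cubeRotation (σ : Perm (Fin 4)) : (cubeRotation σ).det = 1 := by
  rw [det_fin_three]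
  revert σ
  decide +kernel

theorem exists_cubeRotation_sub_one_entry (σ : Perm (Fin 4)) (hσ : σ ≠ 1) :
    ∃ i j, cubeRotation σ i j - (1 : Matrix (Fin 3) (Fin 3) ℤ) i j ∈
      ({1, -1, 2, -2} : Finset ℤ) := by
  revert σ
  decide +kernel

theorem det_signed_permutation (p : Perm (Fin 3)) (s : Fin 3 → ℤˣ) :
    (Matrix.of fun i j => if i = p j then (s j : ℤ) else 0).det = 1 ∨
      (Matrix.of fun i j => if i = p j then (s j : ℤ) else 0).det = -1 := by
  rw [det_fin_three]
  revert p s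
  decide +kernel

theorem exists_cubeRotation_eq (p : Perm (Fin 3)) (s : Fin 3 → ℤˣ)
    (h : (Matrix.of fun i j => if i = p j then (s j : ℤ) else 0).det = 1) :
    ∃ σ, cubeRotation σ = Matrix.of fun i j => if i = p j then (s j : ℤ) else 0 := by
  rw [det_fin_three] at h
  revert p s
  decide +kernel

/-- The double transposition of `Fin 4` mapping `0` to `j.succ`, for each `j`. -/
def doubleTransposition : Fin 3 → Perm (Fin 4) :=
  ![swap 0 1 * swap 2 3, swap 0 2 * swap 1 3, swap 0 3 * swap 1 2]

/-- The normal Klein four subgroup of `S₄`. -/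
def kleinFourPerm : Subgroup (Perm (Fin 4)) where
  carrier := {τ | τ = 1 ∨ ∃ j, τ = doubleTransposition j}
  one_mem' := Or.inl rfl
  mul_mem' := by
    intro σ τ
    revert σ τ
    simp only [Set.mem_ofPred_eq]
    decide +kernel
  inv_mem' := by
    intro σ
    revert σ
    simp only [Set.mem_ofPred_eq]
    decide +kernel

theorem mem_kleinFourPerm {τ : Perm (Fin 4)} :
    τ ∈ kleinFourPerm ↔ τ = 1 ∨ ∃ j, τ = doubleTransposition j := Iff.rfl

instance kleinFourPerm_normal : kleinFourPerm.Normal where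
  conj_mem := by
    simp only [mem_kleinFourPerm]
    decide +kernel

/-- The embedding of `S₃` in `S₄` as the stabilizer of `0`. -/
def permSucc : Perm (Fin 3) →* Perm (Fin 4) :=
  extendDomainHom (finSuccAboveEquiv 0)

theorem permSucc_injective : Function.Injective permSucc :=
  extendDomainHom_injective _

theorem kleinFourPerm_inf_range_permSucc : kleinFourPerm ⊓ permSucc.range = ⊥ := by
  rw [eq_bot_iff]
  rintro _ ⟨h, ρ, rfl⟩
  rw [Subgroup.mem_bot]
  replace h := mem_kleinFourPerm.1 h
  revert ρ
  decide +kernel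

theorem kleinFourPerm_sup_range_permSucc : kleinFourPerm ⊔ permSucc.range = ⊤ := by
  rw [eq_top_iff]
  rintro σ -
  have h : ∃ τ, (τ = 1 ∨ ∃ j, τ = doubleTransposition j) ∧ ∃ ρ, τ * permSucc ρ = σ := by
    revert σ
    decide +kernel
  obtain ⟨τ, hτ, ρ, rfl⟩ := h
  exact Subgroup.mul_mem_sup hτ ⟨ρ, rfl⟩

theorem closure_cycle_swap_fin_three :
    Subgroup.closure {(finRotate 3)⁻¹, swap (1 : Fin 3) 2} = ⊤ := by
  rw [eq_top_iff]
  rintro σ -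
  have h : ∃ m n : Fin 3, σ = (finRotate 3)⁻¹ ^ m.val * swap (1 : Fin 3) 2 ^ n.val := by
    revert σ
    decide +kernel
  obtain ⟨m, n, rfl⟩ := h
  exact mul_mem (pow_mem (Subgroup.subset_closure (by simp)) _)
    (pow_mem (Subgroup.subset_closure (by simp)) _)

theorem cubeRotation_doubleTransposition (j : Fin 3) :
    cubeRotation (doubleTransposition j) = diagonal fun i => if i = j then 1 else -1 := by
  revert j
  decide +kernel

theorem cubeRotation_permSucc_cycle :
    cubeRotation (permSucc (finRotate 3)⁻¹) = !![0, 1, 0; 0, 0, 1; 1, 0, 0] := by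
  decide +kernel

theorem cubeRotation_permSucc_swap :
    cubeRotation (permSucc (swap 1 2)) = !![-1, 0, 0; 0, 0, -1; 0, -1, 0] := by
  decide +kernel

section Field

variable {k : Type} [Field k]

/-- The rotation group of the cube acting on the orthogonal basis of vectors `(t i)⁻¹ eᵢ`. -/
def cubeRep (t : Fin 3 → kˣ) : Perm (Fin 4) →* GL (Fin 3) k :=
  MonoidHom.toHomUnits
    { toFun σ := diagonal (fun i => (t i : k)⁻¹) * (cubeRotation σ).map (Int.cast : ℤ → k) *
        diagonal (fun i => (t i : k))
      map_one' := by simp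
      map_mul' σ τ := by
        have hT (X : Matrix (Fin 3) (Fin 3) k) :
            diagonal (fun i => (t i : k)) * (diagonal (fun i => (t i : k)⁻¹) * X) = X := by
          simp [← Matrix.mul_assoc]
        have hmap : (cubeRotation (σ * τ)).map (Int.cast : ℤ → k) =
            (cubeRotation σ).map Int.cast * (cubeRotation τ).map Int.cast := by
          rw [map_mul]
          exact Matrix.map_mul (f := Int.castRingHom k)
        simp only [hmap, Matrix.mul_assoc, hT] }

theorem val_cubeRep (t : Fin 3 → kˣ) (σ : Perm (Fin 4)) :
    (cubeRep t σ).val = diagonal (fun i => (t i : k)⁻¹) *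
      (cubeRotation σ).map (Int.cast : ℤ → k) * diagonal (fun i => (t i : k)) := rfl

theorem cubeRep_apply (t : Fin 3 → kˣ) (σ : Perm (Fin 4)) (i j : Fin 3) :
    (cubeRep t σ).val i j = (t i : k)⁻¹ * (cubeRotation σ i j : k) * t j := by
  simp [val_cubeRep, diagonal_mul, mul_diagonal]

theorem cubeRep_injective (h2 : (2 : k) ≠ 0) (t : Fin 3 → kˣ) :
    Function.Injective (cubeRep t) := by
  rw [injective_iff_map_eq_one]
  intro σ h
  by_contra hσ
  obtain ⟨i, j, hij⟩ := exists_cubeRotation_sub_one_entry σ hσ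
  have h1 : (cubeRotation σ i j : k) = ((1 : Matrix (Fin 3) (Fin 3) ℤ) i j : ℤ) := by
    have := cubeRep_apply t σ i j
    rw [h] at this
    rcases eq_or_ne i j with rfl | hne
    · simp at this
      field_simp at this
      simpa using this.symm
    · simpa [Matrix.one_apply_ne hne] using this
  rw [← sub_eq_zero, ← Int.cast_sub] at h1
  generalize cubeRotation σ i j - (1 : Matrix (Fin 3) (Fin 3) ℤ) i j = z at *
  simp only [Finset.mem_insert, Finset.mem_singleton] at hij
  rcases hij with rfl | rfl | rfl | rfl <;> simp_all

theorem cubeRep_mem_SO3 (t : Fin 3 → kˣ) (σ : Perm (Fin 4)) :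
    cubeRep t σ ∈ SO3 k (diagonal fun i => (t i : k) ^ 2) := by
  have hR : ((cubeRotation σ).map (Int.cast : ℤ → k))ᵀ * (cubeRotation σ).map Int.cast = 1 := by
    have := congrArg (Int.castRingHom k).mapMatrix (cubeRotation_transpose_mul_self σ)
    rwa [map_mul, map_one] at this
  constructor
  · rw [val_cubeRep]
    simp only [transpose_mul, diagonal_transpose]
    have hT : diagonal (fun i => (t i : k)⁻¹) * diagonal (fun i => (t i : k) ^ 2) *
        diagonal (fun i => (t i : k)⁻¹) = 1 := by
      simp [diagonal_mul_diagonal, pow_two]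
    calc _ = diagonal (fun i => (t i : k)) * (((cubeRotation σ).map (Int.cast : ℤ → k))ᵀ *
          (diagonal (fun i => (t i : k)⁻¹) * diagonal (fun i => (t i : k) ^ 2) *
            diagonal (fun i => (t i : k)⁻¹)) * (cubeRotation σ).map Int.cast) *
          diagonal (fun i => (t i : k)) := by simp only [Matrix.mul_assoc]
      _ = _ := by
        rw [hT, Matrix.mul_one, hR, Matrix.mul_one, diagonal_mul_diagonal]
        simp only [pow_two]
  · have hdet : ((cubeRotation σ).map (Int.cast : ℤ → k)).det = 1 := by
      rw [← Int.cast_det, det_cubeRotation, Int.cast_one]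
    rw [val_cubeRep, det_mul_right_comm]
    simp [hdet]

/-- The nontrivial elements of `kleinFourSet`. -/
def halfTurn (k : Type) [Field k] (j : Fin 3) : Matrix (Fin 3) (Fin 3) k :=
  diagonal fun i => if i = j then 1 else -1

theorem mem_kleinFourSet {x : Matrix (Fin 3) (Fin 3) k} :
    x ∈ kleinFourSet k ↔ x = 1 ∨ ∃ j, x = halfTurn k j := by
  have h0 : (1 : Matrix (Fin 3) (Fin 3) k) = diagonal ![1, 1, 1] := by
    rw [← diagonal_one]; congr 1; ext i; fin_cases i <;> rfl
  have h (j : Fin 3) : halfTurn k j =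
      ![diagonal ![1, -1, -1], diagonal ![-1, 1, -1], diagonal ![-1, -1, 1]] j := by
    fin_cases j <;> simp only [halfTurn] <;> ext i j <;> fin_cases i <;> fin_cases j <;> simp
  simp [kleinFourSet, h0, h, Fin.exists_fin_succ]

theorem halfTurn_injective (h2 : (2 : k) ≠ 0) : Function.Injective (halfTurn k) := by
  intro i j h
  by_contra hij
  have := congrFun (diagonal_injective h) i
  simp only [if_true, if_neg hij] at this
  exact h2 (by linear_combination this)

theorem halfTurn_ne_one (h2 : (2 : k) ≠ 0) (j : Fin 3) : halfTurn k j ≠ 1 := by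
  intro h
  have := congrFun (diagonal_injective (h.trans diagonal_one.symm)) (j + 1)
  simp at this
  exact h2 (by linear_combination -this)

theorem cubeRep_doubleTransposition (t : Fin 3 → kˣ) (j : Fin 3) :
    (cubeRep t (doubleTransposition j)).val = halfTurn k j := by
  ext i l
  rw [cubeRep_apply, cubeRotation_doubleTransposition, halfTurn]
  rcases eq_or_ne i l with rfl | h
  · by_cases hij : i = j <;> simp [hij]
  · simp [h]

theorem mem_kleinFourSet_iff_mem_map (t : Fin 3 → kˣ) (x : GL (Fin 3) k) :
    x.val ∈ kleinFourSet k ↔ x ∈ kleinFourPerm.map (cubeRep t) := by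
  rw [mem_kleinFourSet]
  constructor
  · rintro (h | ⟨j, h⟩)
    · rw [Units.val_eq_one] at h
      exact h ▸ one_mem _
    · exact ⟨_, Or.inr ⟨j, rfl⟩, Units.ext ((cubeRep_doubleTransposition t j).trans h.symm)⟩
  · rintro ⟨τ, rfl | ⟨j, rfl⟩, rfl⟩
    · simp
    · exact Or.inr ⟨j, cubeRep_doubleTransposition t j⟩

/-- A matrix normalizing the diagonal Klein four group is monomial. -/
theorem exists_perm_of_conj_mem_kleinFourSet (h2 : (2 : k) ≠ 0) (M : GL (Fin 3) k)
    (hM : ∀ x : GL (Fin 3) k, x.val ∈ kleinFourSet k → (M * x * M⁻¹).val ∈ kleinFourSet k) :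
    ∃ p : Perm (Fin 3), ∀ i j, i ≠ p j → M.val i j = 0 := by
  have hconj (j : Fin 3) : ∃ l, M.val * halfTurn k j = halfTurn k l * M.val := by
    obtain ⟨x, hx⟩ : ∃ x : GL (Fin 3) k, x.val = halfTurn k j :=
      ⟨_, cubeRep_doubleTransposition 1 j⟩
    rcases mem_kleinFourSet.1 (hM x (mem_kleinFourSet.2 (Or.inr ⟨j, hx⟩))) with h | ⟨l, h⟩
    · rw [Units.val_eq_one, mul_inv_eq_one, mul_eq_left] at h
      exact absurd (hx ▸ Units.val_eq_one.2 h) (halfTurn_ne_one h2 j)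
    · exact ⟨l, by rw [← h, ← hx, ← Units.val_mul, ← Units.val_mul]; simp⟩
  choose p hp using hconj
  have hinj : Function.Injective p := by
    intro i j hij
    refine halfTurn_injective h2 (M.isUnit.mul_left_cancel ?_)
    rw [hp, hp, hij]
  refine ⟨Equiv.ofBijective p (Finite.injective_iff_bijective.1 hinj), fun i j hij => ?_⟩
  have := congrFun (congrFun (hp j) i) j
  simp only [Equiv.ofBijective_apply] at hij
  simp [halfTurn, diagonal_mul, mul_diagonal, hij] at this
  have h : (2 : k) * M.val i j = 0 := by linear_combination this
  exact (mul_eq_zero.1 h).resolve_left h2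

theorem mem_range_cubeRep (h2 : (2 : k) ≠ 0) (t : Fin 3 → kˣ) (M : GL (Fin 3) k)
    (hSO : M ∈ SO3 k (diagonal fun i => (t i : k) ^ 2))
    (hM : ∀ x : GL (Fin 3) k, x.val ∈ kleinFourSet k → (M * x * M⁻¹).val ∈ kleinFourSet k) :
    M ∈ (cubeRep t).range := by
  obtain ⟨hQ, hdet⟩ := hSO
  obtain ⟨p, hp⟩ := exists_perm_of_conj_mem_kleinFourSet h2 M hM
  have hsign (j : Fin 3) : ∃ s : ℤˣ, M.val (p j) j = (t (p j) : k)⁻¹ * ((s : ℤ) : k) * t j := by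
    have h := congrFun (congrFun hQ j) j
    rw [Matrix.mul_apply, Finset.sum_eq_single (p j)
      (fun i _ hi => by rw [hp i j hi, mul_zero]) (by simp), mul_diagonal, diagonal_apply_eq,
      transpose_apply] at h
    have h' : (t (p j) * M.val (p j) j) ^ 2 = (t j : k) ^ 2 := by linear_combination h
    rcases sq_eq_sq_iff_eq_or_eq_neg.1 h' with h | h
    · exact ⟨1, by simp [← h]⟩
    · exact ⟨-1, by simp [neg_eq_iff_eq_neg.1 h.symm]⟩
  choose s hs using hsign
  set B : Matrix (Fin 3) (Fin 3) ℤ := Matrix.of fun i j => if i = p j then (s j : ℤ) else 0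
  have hMB : M.val = diagonal (fun i => (t i : k)⁻¹) * B.map (Int.cast : ℤ → k) *
      diagonal (fun i => (t i : k)) := by
    ext i j
    simp only [mul_diagonal, diagonal_mul, map_apply, B, of_apply]
    split_ifs with h
    · rw [h, hs]
    · simp [hp i j h]
  have hB : B.det = 1 := by
    refine (det_signed_permutation p s).resolve_right fun h => h2 ?_
    have hk : (B.map (Int.cast : ℤ → k)).det = -1 := by
      rw [← Int.cast_det, h, Int.cast_neg, Int.cast_one]
    rw [hMB, det_mul_right_comm] at hdet
    simp [hk] at hdet
    linear_combination -hdet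
  obtain ⟨σ, hσ⟩ := exists_cubeRotation_eq p s hB
  exact ⟨σ, Units.ext (by rw [val_cubeRep, hσ, hMB])⟩

end Field

/-- Suppose `u² = -a` and `v² = -b` in `k`, and let `q = ⟨-a,-b,ab⟩`.  Then the normalizer
of the diagonal Klein four subgroup `D₀` in `SO(q)(k)` is isomorphic to `S₄`; explicitly,
it is the (internal) semidirect product of `D₀` with the subgroup `N' ≅ S₃` generated by
the matrices `[[0, v u⁻¹, 0],[0,0,u],[v⁻¹,0,0]]` and `[[-1,0,0],[0,0,-u],[0,-u⁻¹,0]]`. -/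
theorem normalizer_of_klein_four
    (k : Type) [Field k] (hchar : ringChar k ≠ 2)
    (a b : k) (ha : a ≠ 0) (hb : b ≠ 0)
    (u v : k) (hu : u ^ 2 = -a) (hv : v ^ 2 = -b)
    (n₁ n₂ : GL (Fin 3) k)
    (hn₁ : (n₁ : Matrix (Fin 3) (Fin 3) k) = !![0, v * u⁻¹, 0; 0, 0, u; v⁻¹, 0, 0])
    (hn₂ : (n₂ : Matrix (Fin 3) (Fin 3) k) = !![-1, 0, 0; 0, 0, -u; 0, -u⁻¹, 0]) :
    ∃ Nor D N' : Subgroup (GL (Fin 3) k),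
      (Nor : Set (GL (Fin 3) k)) =
        {M | M ∈ SO3 k (Matrix.diagonal ![-a, -b, a * b]) ∧
          (∀ x : GL (Fin 3) k, (x : Matrix (Fin 3) (Fin 3) k) ∈ kleinFourSet k →
            ((M⁻¹ * x * M : GL (Fin 3) k) : Matrix (Fin 3) (Fin 3) k) ∈ kleinFourSet k) ∧
          (∀ x : GL (Fin 3) k, (x : Matrix (Fin 3) (Fin 3) k) ∈ kleinFourSet k →
            ((M * x * M⁻¹ : GL (Fin 3) k) : Matrix (Fin 3) (Fin 3) k) ∈ kleinFourSet k)} ∧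
      Units.val '' (D : Set (GL (Fin 3) k)) = kleinFourSet k ∧
      N' = Subgroup.closure {n₁, n₂} ∧
      Nonempty (Nor ≃* Equiv.Perm (Fin 4)) ∧
      Nonempty (N' ≃* Equiv.Perm (Fin 3)) ∧
      D ≤ Nor ∧ N' ≤ Nor ∧
      (∀ g ∈ Nor, ∀ d ∈ D, g * d * g⁻¹ ∈ D) ∧
      D ⊓ N' = ⊥ ∧ D ⊔ N' = Nor := by
  have h2 : (2 : k) ≠ 0 := Ring.two_ne_zero hchar
  have hu0 : u ≠ 0 := by rintro rfl; exact ha (by simpa using hu.symm)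
  have hv0 : v ≠ 0 := by rintro rfl; exact hb (by simpa using hv.symm)
  set t : Fin 3 → kˣ := ![Units.mk0 u hu0, Units.mk0 v hv0, Units.mk0 (u * v) (mul_ne_zero hu0 hv0)]
  have hQ : diagonal ![-a, -b, a * b] = diagonal fun i => (t i : k) ^ 2 := by
    congr 1
    ext i
    fin_cases i
    · simp [t, hu]
    · simp [t, hv]
    · simp [t, mul_pow, hu, hv]
  have hinj := cubeRep_injective h2 t
  have h₁ : n₁ = cubeRep t (permSucc (finRotate 3)⁻¹) := by
    ext i j
    rw [cubeRep_apply, cubeRotation_permSucc_cycle, hn₁]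
    fin_cases i <;> fin_cases j <;> simp [t] <;> field_simp
  have h₂ : n₂ = cubeRep t (permSucc (swap 1 2)) := by
    ext i j
    rw [cubeRep_apply, cubeRotation_permSucc_swap, hn₂]
    fin_cases i <;> fin_cases j <;> simp [t] <;> field_simp
  have hN : Subgroup.closure {n₁, n₂} = permSucc.range.map (cubeRep t) := by
    rw [MonoidHom.range_eq_map, ← closure_cycle_swap_fin_three, MonoidHom.map_closure,
      MonoidHom.map_closure, Set.image_pair, Set.image_pair, h₁, h₂]
  refine ⟨(cubeRep t).range, kleinFourPerm.map (cubeRep t), _, ?_, ?_, rfl,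
    ⟨(MonoidHom.ofInjective hinj).symm⟩, ?_, ?_, ?_, ?_, ?_, ?_⟩
  · simp only [hQ, mem_kleinFourSet_iff_mem_map t]
    ext M
    constructor
    · rintro ⟨σ, rfl⟩
      refine ⟨cubeRep_mem_SO3 t σ, ?_, ?_⟩
      · rintro _ ⟨τ, hτ, rfl⟩
        exact ⟨σ⁻¹ * τ * σ, kleinFourPerm_normal.conj_mem' τ hτ σ, by simp⟩
      · rintro _ ⟨τ, hτ, rfl⟩
        exact ⟨σ * τ * σ⁻¹, kleinFourPerm_normal.conj_mem τ hτ σ, by simp⟩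
    · rintro ⟨hSO, -, hM⟩
      exact mem_range_cubeRep h2 t M hSO (by simpa only [mem_kleinFourSet_iff_mem_map t] using hM)
  · ext x
    constructor
    · rintro ⟨x, hx, rfl⟩
      exact (mem_kleinFourSet_iff_mem_map t x).2 hx
    · intro hx
      obtain ⟨y, rfl⟩ : ∃ y : GL (Fin 3) k, y.val = x := by
        rcases mem_kleinFourSet.1 hx with rfl | ⟨j, rfl⟩
        · exact ⟨1, rfl⟩
        · exact ⟨_, cubeRep_doubleTransposition t j⟩
      exact ⟨y, (mem_kleinFourSet_iff_mem_map t y).1 hx, rfl⟩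
  · rw [hN, MonoidHom.map_range]
    exact ⟨(MonoidHom.ofInjective
      (show Function.Injective ((cubeRep t).comp permSucc) from
        hinj.comp permSucc_injective)).symm⟩
  · exact Subgroup.map_le_range _ _
  · rw [hN]
    exact Subgroup.map_le_range _ _
  · rintro _ ⟨σ, rfl⟩ _ ⟨τ, hτ, rfl⟩
    exact ⟨σ * τ * σ⁻¹, kleinFourPerm_normal.conj_mem τ hτ σ, by simp⟩
  · rw [hN, ← Subgroup.map_inf _ _ _ hinj, kleinFourPerm_inf_range_permSucc, Subgroup.map_bot]
  · rw [hN, ← Subgroup.map_sup, kleinFourPerm_sup_range_permSucc, MonoidHom.range_eq_map]
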